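/- arXiv:1506.00880 — 2 statements merged into one kernel-verified Lean document; each statement's English description precedes it below -/
import Mathlib

section
/- Let N ≥ 2 and let ℒ₁ and ℒ₂ be symmetric positive semidefinite N×N real matrices with ℒ₁𝟙_N = 0 and ℒ₂𝟙_N = 0, admitting eigendecompositions ℒ₁ = RΛ₁R⁻¹ and ℒ₂ = UΛ₂U⁻¹, where R = √N·V₁ and U = √N·V₂ for real orthogonal matrices V₁, V₂ whose first columns equal (1/√N)·𝟙_N, and Λ₁, Λ₂ are diagonal with first diagonal entry 0. Let R₂₂ and U₂₂ be the lower-right (N−1)×(N−1) blocks of R⁻¹ and U⁻¹ respectively, let Λ̄₂ = diag(λ₂(ℒ₂),…,λ_N(ℒ₂)) be Λ₂ with its first (zero) entry removed, and set T = N·R₂₂·(𝟙_{N−1}𝟙_{N−1}ᵀ + I_{N−1})·U₂₂ᵀ. Then for every n ≥ 1, (R⁻¹ℒ₂R) ⊗ I_n is block diagonal with an n×n zero block in the top-left corner and the block (T·Λ̄₂·Tᵀ) ⊗ I_n in the bottom-right corner; moreover T is orthogonal (T⁻¹ = Tᵀ), so T·Λ̄₂·Tᵀ is symmetric, and it is positive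 definite whenever all the λ_k(ℒ₂), k = 2,…,N, are positive. -/
open Matrix
open scoped Kronecker

noncomputable section

/-- The index `0` of `Fin N` when `N ≥ 2`. -/
def e0 {N : ℕ} (hN : 2 ≤ N) : Fin N := ⟨0, by omega⟩

/-- The embedding `Fin (N-1) → Fin N`, `i ↦ i + 1`. -/
def emb {N : ℕ} (hN : 2 ≤ N) (i : Fin (N - 1)) : Fin N :=
  ⟨i.1 + 1, by have := i.2; omega⟩

/-- The "predecessor" map `Fin N → Fin (N-1)`, `i ↦ i − 1` (sending `0` to `0`). -/
def predF {N : ℕ} (hN : 2 ≤ N) (i : Fin N) : Fin (N - 1) :=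
  ⟨i.1 - 1, by have := i.2; omega⟩

/-- Given an orthogonal matrix `V`, `Rinv V = (1/N)·Rᵀ` where `R = √N·V`. -/
def Rinv {N : ℕ} (V : Matrix (Fin N) (Fin N) ℝ) : Matrix (Fin N) (Fin N) ℝ :=
  (1 / (N : ℝ)) • (Real.sqrt N • V).transpose

/-- The lower-right `(N-1)×(N-1)` block of `R⁻¹`. -/
def R22 {N : ℕ} (hN : 2 ≤ N) (V : Matrix (Fin N) (Fin N) ℝ) :
    Matrix (Fin (N - 1)) (Fin (N - 1)) ℝ :=
  Matrix.of fun i j => Rinv V (emb hN i) (emb hN j)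

/-- The `k×k` all-ones matrix `𝟙𝟙ᵀ`. -/
def onesM (k : ℕ) : Matrix (Fin k) (Fin k) ℝ := Matrix.of fun _ _ => 1

theorem sum_eq_e0_add_sum_emb {N : ℕ} (hN : 2 ≤ N) (f : Fin N → ℝ) :
    ∑ i, f i = f (e0 hN) + ∑ i, f (emb hN i) := by
  obtain ⟨m, rfl⟩ : ∃ m, N = m + 1 := ⟨N - 1, by omega⟩
  exact Fin.sum_univ_succ f

theorem emb_ne_e0 {N : ℕ} (hN : 2 ≤ N) (i : Fin (N - 1)) : emb hN i ≠ e0 hN := by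
  simp [emb, e0, Fin.ext_iff]

theorem emb_injective {N : ℕ} (hN : 2 ≤ N) : Function.Injective (emb hN) := by
  intro i j h
  simpa [emb, Fin.ext_iff] using h

theorem emb_predF {N : ℕ} (hN : 2 ≤ N) {i : Fin N} (hi : i ≠ e0 hN) :
    emb hN (predF hN i) = i := by
  have h : i.1 ≠ 0 := fun h => hi (Fin.ext h)
  apply Fin.ext
  simp only [emb, predF]
  omega

/-- If the first column of an orthogonal matrix is constant, the other columns sum to zero. -/
theorem sum_col_eq {N : ℕ} (hN : 2 ≤ N) {V : Matrix (Fin N) (Fin N) ℝ}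
    (hV : V.transpose * V = 1) (hcol : ∀ i : Fin N, V i (e0 hN) = 1 / Real.sqrt N)
    {j : Fin N} (hj : j ≠ e0 hN) : ∑ k, V k j = 0 := by
  have h := congrFun (congrFun hV (e0 hN)) j
  rw [Matrix.one_apply_ne hj.symm, Matrix.mul_apply] at h
  simp only [Matrix.transpose_apply, hcol, ← Finset.mul_sum] at h
  have hs : (1 : ℝ) / Real.sqrt N ≠ 0 := by
    have : (0 : ℝ) < N := by exact_mod_cast (by omega : 0 < N)
    positivity
  exact (mul_eq_zero.mp h).resolve_left hs

/-- `T = N·R₂₂·(𝟙𝟙ᵀ + I)·U₂₂ᵀ` is the lower-right block of `V₁ᵀV₂`. -/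
theorem smul_R22_mul_eq_submatrix {N : ℕ} (hN : 2 ≤ N) {V1 V2 : Matrix (Fin N) (Fin N) ℝ}
    (hV1 : V1.transpose * V1 = 1) (hV2 : V2.transpose * V2 = 1)
    (hcol1 : ∀ i : Fin N, V1 i (e0 hN) = 1 / Real.sqrt N)
    (hcol2 : ∀ i : Fin N, V2 i (e0 hN) = 1 / Real.sqrt N) :
    (N : ℝ) • (R22 hN V1 * (onesM (N - 1) + 1) * (R22 hN V2).transpose) =
      (V1.transpose * V2).submatrix (emb hN) (emb hN) := by
  have hpos : (0 : ℝ) < N := by exact_mod_cast (by omega : 0 < N)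
  have hs : Real.sqrt N * Real.sqrt N = N := Real.mul_self_sqrt hpos.le
  ext i j
  have h1 := sum_col_eq hN hV1 hcol1 (emb_ne_e0 hN i)
  have h2 := sum_col_eq hN hV2 hcol2 (emb_ne_e0 hN j)
  rw [sum_eq_e0_add_sum_emb hN] at h1 h2
  have hR : ∀ (V : Matrix (Fin N) (Fin N) ℝ) (i k : Fin (N - 1)),
      R22 hN V i k = (1 / N * Real.sqrt N) * V (emb hN k) (emb hN i) := by
    intro V i k
    simp [R22, Rinv, mul_assoc]
  have hc : (N : ℝ) * ((1 / N * Real.sqrt N) * (1 / N * Real.sqrt N)) = 1 := by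
    rw [show (N : ℝ) * ((1 / N * Real.sqrt N) * (1 / N * Real.sqrt N)) =
      N * (1 / N * (1 / N)) * (Real.sqrt N * Real.sqrt N) by ring, hs]
    field_simp
  have hones : (R22 hN V1 * onesM (N - 1) * (R22 hN V2).transpose) i j =
      (∑ k, R22 hN V1 i k) * ∑ k, R22 hN V2 j k := by
    simp [Matrix.mul_apply, onesM, Finset.mul_sum]
  rw [Matrix.mul_add, Matrix.mul_one, Matrix.add_mul, Matrix.smul_apply, Matrix.add_apply, hones]
  simp only [Matrix.submatrix_apply, Matrix.mul_apply, Matrix.transpose_apply]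
  rw [sum_eq_e0_add_sum_emb hN (fun k => V1 k (emb hN i) * V2 k (emb hN j)),
    eq_neg_of_add_eq_zero_left h1, eq_neg_of_add_eq_zero_left h2]
  simp only [hR, ← Finset.mul_sum, smul_eq_mul]
  rw [show ∑ k, (1 / N * Real.sqrt N) * V1 (emb hN k) (emb hN i) *
      ((1 / N * Real.sqrt N) * V2 (emb hN k) (emb hN j)) =
      ((1 / N * Real.sqrt N) * (1 / N * Real.sqrt N)) *
        ∑ k, V1 (emb hN k) (emb hN i) * V2 (emb hN k) (emb hN j) by
    rw [Finset.mul_sum]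
    exact Finset.sum_congr rfl fun k _ => by ring]
  linear_combination ((∑ k, V1 (emb hN k) (emb hN i)) * (∑ k, V2 (emb hN k) (emb hN j)) +
    ∑ k, V1 (emb hN k) (emb hN i) * V2 (emb hN k) (emb hN j)) * hc

/-- Orthogonal matrices with the same constant first column: `V₁ᵀV₂` has trivial first column. -/
theorem transpose_mul_apply_e0 {N : ℕ} (hN : 2 ≤ N) {V1 V2 : Matrix (Fin N) (Fin N) ℝ}
    (hV1 : V1.transpose * V1 = 1)
    (hcol1 : ∀ i : Fin N, V1 i (e0 hN) = 1 / Real.sqrt N)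
    (hcol2 : ∀ i : Fin N, V2 i (e0 hN) = 1 / Real.sqrt N)
    {i : Fin N} (hi : i ≠ e0 hN) : (V1.transpose * V2) i (e0 hN) = 0 := by
  simp only [Matrix.mul_apply, Matrix.transpose_apply, hcol2, ← Finset.sum_mul,
    sum_col_eq hN hV1 hcol1 hi, zero_mul]

/-- Conjugation by `R = √N·V` is conjugation by the orthogonal matrix `V`. -/
theorem Rinv_mul_mul_smul {N : ℕ} (hN : 2 ≤ N) (V M : Matrix (Fin N) (Fin N) ℝ) :
    Rinv V * M * (Real.sqrt N • V) = V.transpose * M * V := by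
  have hpos : (0 : ℝ) < N := by exact_mod_cast (by omega : 0 < N)
  have hs : Real.sqrt N * Real.sqrt N = N := Real.mul_self_sqrt hpos.le
  simp only [Rinv, Matrix.transpose_smul, Matrix.smul_mul, Matrix.mul_smul, smul_smul]
  rw [show Real.sqrt N * (1 / N * Real.sqrt N) = 1 by
    rw [show Real.sqrt N * (1 / N * Real.sqrt N) = 1 / N * (Real.sqrt N * Real.sqrt N) by ring, hs]
    field_simp, one_smul]

theorem smul_mul_mul_Rinv {N : ℕ} (hN : 2 ≤ N) (V M : Matrix (Fin N) (Fin N) ℝ) :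
    (Real.sqrt N • V) * M * Rinv V = V * M * V.transpose := by
  have hpos : (0 : ℝ) < N := by exact_mod_cast (by omega : 0 < N)
  have hs : Real.sqrt N * Real.sqrt N = N := Real.mul_self_sqrt hpos.le
  simp only [Rinv, Matrix.transpose_smul, Matrix.smul_mul, Matrix.mul_smul, smul_smul]
  rw [show 1 / N * Real.sqrt N * Real.sqrt N = 1 by
    rw [mul_assoc, hs]
    field_simp, one_smul]

theorem mul_diagonal_mul_transpose_apply {m : Type*} [Fintype m] [DecidableEq m]
    (W : Matrix m m ℝ) (d : m → ℝ) (i j : m) :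
    (W * Matrix.diagonal d * W.transpose) i j = ∑ k, W i k * d k * W j k := by
  rw [Matrix.mul_apply]
  simp only [Matrix.mul_diagonal, Matrix.transpose_apply]

/-- Let `N ≥ 2` and let `ℒ₁, ℒ₂` be symmetric positive semidefinite `N×N`
matrices with `ℒ₁𝟙 = ℒ₂𝟙 = 0`, with eigendecompositions `ℒ₁ = RΛ₁R⁻¹` and
`ℒ₂ = UΛ₂U⁻¹` where `R = √N·V₁`, `U = √N·V₂` for orthogonal `V₁, V₂` whose
first columns equal `(1/√N)·𝟙`, and `Λ₁, Λ₂` diagonal with first entry `0`.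
With `R₂₂, U₂₂` the lower-right blocks of `R⁻¹, U⁻¹`,
`Λ̄₂ = diag(λ₂(ℒ₂),…,λ_N(ℒ₂))` and
`T = N·R₂₂·(𝟙𝟙ᵀ + I)·U₂₂ᵀ`, for every `n ≥ 1` the matrix `(R⁻¹ℒ₂R) ⊗ I_n` is
block diagonal with a zero `n×n` top-left block and bottom-right block
`(T·Λ̄₂·Tᵀ) ⊗ I_n`; moreover `T` is orthogonal, `T·Λ̄₂·Tᵀ` is symmetric, and it
is positive definite whenever all `λ_k(ℒ₂)`, `k ≥ 2`, are positive. -/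
theorem stmt_5 {N : ℕ} (hN : 2 ≤ N)
    (L1 L2 : Matrix (Fin N) (Fin N) ℝ)
    (hL1 : L1.PosSemidef) (hL2 : L2.PosSemidef)
    (hL1one : L1.mulVec (fun _ => 1) = 0) (hL2one : L2.mulVec (fun _ => 1) = 0)
    (V1 V2 : Matrix (Fin N) (Fin N) ℝ)
    (hV1 : V1.transpose * V1 = 1) (hV2 : V2.transpose * V2 = 1)
    (hcol1 : ∀ i : Fin N, V1 i (e0 hN) = 1 / Real.sqrt N)
    (hcol2 : ∀ i : Fin N, V2 i (e0 hN) = 1 / Real.sqrt N)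
    (d1 d2 : Fin N → ℝ) (hd1 : d1 (e0 hN) = 0) (hd2 : d2 (e0 hN) = 0)
    (hdec1 : L1 = (Real.sqrt N • V1) * Matrix.diagonal d1 * Rinv V1)
    (hdec2 : L2 = (Real.sqrt N • V2) * Matrix.diagonal d2 * Rinv V2) :
    let T : Matrix (Fin (N - 1)) (Fin (N - 1)) ℝ :=
      (N : ℝ) • (R22 hN V1 * (onesM (N - 1) + 1) * (R22 hN V2).transpose)
    let dbar : Matrix (Fin (N - 1)) (Fin (N - 1)) ℝ :=
      Matrix.diagonal (fun i => d2 (emb hN i))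
    (∀ (n : ℕ), 1 ≤ n → ∀ p q : Fin N × Fin n,
      ((Rinv V1 * L2 * (Real.sqrt N • V1)) ⊗ₖ (1 : Matrix (Fin n) (Fin n) ℝ)) p q =
        if p.1 = e0 hN ∨ q.1 = e0 hN then 0
        else (T * dbar * T.transpose) (predF hN p.1) (predF hN q.1) *
          (if p.2 = q.2 then 1 else 0)) ∧
    T * T.transpose = 1 ∧
    (T * dbar * T.transpose).IsSymm ∧
    ((∀ i : Fin (N - 1), 0 < d2 (emb hN i)) → (T * dbar * T.transpose).PosDef) := by
  intro T dbar
  set W := V1.transpose * V2 with hW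
  have hT : T = W.submatrix (emb hN) (emb hN) :=
    smul_R22_mul_eq_submatrix hN hV1 hV2 hcol1 hcol2
  have hWi : ∀ i, i ≠ e0 hN → W i (e0 hN) = 0 := fun i hi =>
    transpose_mul_apply_e0 hN hV1 hcol1 hcol2 hi
  have hW0 : ∀ j, j ≠ e0 hN → W (e0 hN) j = 0 := fun j hj => by
    rw [← transpose_mul_apply_e0 hN hV2 hcol2 hcol1 hj, ← Matrix.transpose_apply W,
      hW, Matrix.transpose_mul, Matrix.transpose_transpose]
  have hWW : W * W.transpose = 1 := by
    rw [hW, Matrix.transpose_mul, Matrix.transpose_transpose, Matrix.mul_assoc,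
      ← Matrix.mul_assoc V2, mul_eq_one_comm.mp hV2, Matrix.one_mul, hV1]
  have hconj : Rinv V1 * L2 * (Real.sqrt N • V1) = W * Matrix.diagonal d2 * W.transpose := by
    rw [Rinv_mul_mul_smul hN, hdec2, smul_mul_mul_Rinv hN, hW, Matrix.transpose_mul,
      Matrix.transpose_transpose]
    simp only [Matrix.mul_assoc]
  have hTT : T * T.transpose = 1 := by
    ext i j
    have h := congrFun (congrFun hWW (emb hN i)) (emb hN j)
    rw [Matrix.mul_apply, sum_eq_e0_add_sum_emb hN, hWi _ (emb_ne_e0 hN i), zero_mul,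
      zero_add] at h
    rw [hT, Matrix.mul_apply]
    simpa [Matrix.one_apply, (emb_injective hN).eq_iff] using h
  refine ⟨fun n _ p q => ?_, hTT, ?_, fun hd => ?_⟩
  · rw [Matrix.kroneckerMap_apply, hconj, mul_diagonal_mul_transpose_apply,
      sum_eq_e0_add_sum_emb hN, hd2, mul_zero, zero_mul, zero_add]
    by_cases h : p.1 = e0 hN ∨ q.1 = e0 hN
    · rw [if_pos h, Finset.sum_eq_zero, zero_mul]
      intro k _
      rcases h with h | h <;> simp [h, hW0 _ (emb_ne_e0 hN k)]
    · rw [if_neg h, mul_diagonal_mul_transpose_apply, Matrix.one_apply, hT]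
      rw [not_or] at h
      simp only [Matrix.submatrix_apply, emb_predF hN h.1, emb_predF hN h.2]
  · simp [Matrix.IsSymm, Matrix.transpose_mul, dbar, Matrix.mul_assoc]
  · have hinj : Function.Injective T.vecMul :=
      Matrix.vecMul_injective_of_isUnit (IsUnit.of_mul_eq_one _ hTT)
    simpa [Matrix.conjTranspose_eq_transpose_of_trivial] using
      (Matrix.PosDef.diagonal hd).mul_mul_conjTranspose_same hinj

end
end

section
/- Consider the closed-loop linearized power network on N ≥ 2 buses: ω̇(t) = (H − σ_P·ℒ_P)·ω(t) + z(t) + B and ż(t) = −M·ℒ_I·ω(t), where H = diag(k₁ − d₁/m₁, …, k_N − d_N/m_N), M = diag(1/m₁, …, 1/m_N) with all m_i > 0, B = (P₁*/m₁, …, P_N*/m_N)ᵀ, σ_P > 0, ℒ_P is a graph Laplacian, and ℒ_I is the Laplacian of a connected weighted undirected graph. If Σ_{i=1}^N (m_i·k_i − d_i) ≠ 0, then the unique pair (ω*, z*) ∈ ℝ^N × ℝ^N satisfying (H − σ_P·ℒ_P)ω* + z* + B = 0, ℒ_I·ω* = 0, and vᵀz* = 0 with v = (m₁, …, m_N)ᵀ,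 is ω* = ω_∞·𝟙_N with ω_∞ = −(Σ_{i=1}^N P_i*) / (Σ_{i=1}^N (m_i·k_i − d_i)), and z* = −(ω_∞·H·𝟙_N + B). -/
open Matrix

noncomputable section

/-- `L` is the Laplacian of a weighted undirected graph on `N` nodes. -/
def IsLaplacian {N : ℕ} (L : Matrix (Fin N) (Fin N) ℝ) : Prop :=
  ∃ A : Matrix (Fin N) (Fin N) ℝ, A.IsSymm ∧ (∀ i j, 0 ≤ A i j) ∧
    (∀ i, A i i = 0) ∧ L = Matrix.diagonal (fun i => ∑ j, A i j) - A

/-- `L` is the Laplacian of a *connected* weighted undirected graph: its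
kernel is spanned by the all-ones vector. -/
def IsConnLaplacian {N : ℕ} (L : Matrix (Fin N) (Fin N) ℝ) : Prop :=
  IsLaplacian L ∧ ∀ v : Fin N → ℝ, L.mulVec v = 0 → ∃ c : ℝ, v = fun _ => c

/-- The Laplacian of a weighted graph annihilates constant vectors. -/
theorem IsLaplacian.mulVec_const {N : ℕ} {L : Matrix (Fin N) (Fin N) ℝ} (hL : IsLaplacian L)
    (c : ℝ) : L.mulVec (fun _ => c) = 0 := by
  obtain ⟨A, -, -, -, rfl⟩ := hL
  ext i
  rw [Matrix.sub_mulVec, Pi.sub_apply, Matrix.mulVec_diagonal]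
  simp [Matrix.mulVec, dotProduct, Finset.sum_mul]

/-- Equilibrium of the closed-loop linearized power network: if
`Σ (m_i·k_i − d_i) ≠ 0`, the unique pair `(ω*, z*)` with
`(H − σ_P·ℒ_P)ω* + z* + B = 0`, `ℒ_I·ω* = 0` and `vᵀz* = 0` (where
`v = (m₁,…,m_N)ᵀ`) is `ω* = ω_∞·𝟙` with
`ω_∞ = −(Σ P_i*)/(Σ (m_i·k_i − d_i))` and `z* = −(ω_∞·H·𝟙 + B)`. -/
theorem stmt_15 {N : ℕ} (hN : 2 ≤ N)
    (m d k P : Fin N → ℝ) (hm : ∀ i, 0 < m i)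
    (σP : ℝ) (hσP : 0 < σP)
    (LP LI : Matrix (Fin N) (Fin N) ℝ)
    (hLP : IsLaplacian LP) (hLI : IsConnLaplacian LI)
    (hsum : (∑ i, (m i * k i - d i)) ≠ 0) :
    let H : Matrix (Fin N) (Fin N) ℝ := Matrix.diagonal fun i => k i - d i / m i
    let B : Fin N → ℝ := fun i => P i / m i
    let ωinf : ℝ := -(∑ i, P i) / (∑ i, (m i * k i - d i))
    let ωstar : Fin N → ℝ := fun _ => ωinf
    let zstar : Fin N → ℝ := -(ωinf • H.mulVec (fun _ => 1) + B)
    ∀ ω z : Fin N → ℝ,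
      ((H - σP • LP).mulVec ω + z + B = 0 ∧
        LI.mulVec ω = 0 ∧
        (fun i => m i) ⬝ᵥ z = 0) ↔
      (ω = ωstar ∧ z = zstar) := by
  intro H B ωinf ωstar zstar ω z
  have hH : ∀ (c : ℝ) (i : Fin N),
      ((H - σP • LP).mulVec fun _ => c) i = (k i - d i / m i) * c := by
    intro c i
    rw [Matrix.sub_mulVec, Matrix.smul_mulVec, hLP.mulVec_const, smul_zero, sub_zero]
    exact Matrix.mulVec_diagonal _ _ i
  have hz : ∀ i, zstar i = -(ωinf * (k i - d i / m i) + P i / m i) := by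
    intro i
    simp [zstar, H, B, Matrix.mulVec_diagonal]
  have hweighted : ∀ c : ℝ, ∑ i, m i * -(c * (k i - d i / m i) + P i / m i) =
      -(c * ∑ i, (m i * k i - d i) + ∑ i, P i) := by
    intro c
    rw [Finset.mul_sum, ← Finset.sum_add_distrib, ← Finset.sum_neg_distrib]
    refine Finset.sum_congr rfl fun i _ => ?_
    have := (hm i).ne'
    field_simp
  constructor
  · rintro ⟨heq, hker, horth⟩
    obtain ⟨c, rfl⟩ := hLI.2 ω hker
    have hzc : ∀ i, z i = -(c * (k i - d i / m i) + P i / m i) := by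
      intro i
      have h := congrFun heq i
      simp only [Pi.add_apply, Pi.zero_apply, hH, B] at h
      linarith
    have hc : c = ωinf := by
      simp only [dotProduct, hzc, hweighted] at horth
      rw [eq_div_iff hsum]
      linarith
    subst hc
    exact ⟨rfl, funext fun i => (hzc i).trans (hz i).symm⟩
  · rintro ⟨rfl, rfl⟩
    refine ⟨?_, hLI.1.mulVec_const _, ?_⟩
    · ext i
      simp only [Pi.add_apply, Pi.zero_apply, ωstar, hH, hz, B]
      ring
    · simp only [dotProduct, hz, hweighted]
      rw [div_mul_cancel₀ _ hsum]
      ring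

end
end
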